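/- Let Ω ⊆ ℍ be a symmetric slice domain and let f₁, f₂ : Ω → ℍ be slice regular functions with no common zeros, i.e. for every q ∈ Ω either f₁(q) ≠ 0 or f₂(q) ≠ 0. Fix I, J ∈ 𝕊 with IJ = −JI and holomorphic functions F_ℓ, G_ℓ : Ω_I → L_I with f_ℓ(z) = F_ℓ(z) + G_ℓ(z)J on Ω_I (ℓ = 1, 2). For z ∈ Ω_I let A(z) be the 4×6 matrix over the field L_I ≅ ℂ whose rows are (G₁, F₂, G₂, 0, 0, 0), (−F₁, 0, 0, F₂, G₂, 0), (0, −F₁, 0, −G₁, 0, G₂), (0, 0, −F₁, 0, −G₁, −F₂), all evaluated at z, and let B(z) be the 4×6 matrix whose rows are (F̂₁, 0, 0, −F̂₂, −Ĝ₂, 0), (Ĝ₁, F̂₂, Ĝ₂, 0, 0, 0), (0, 0, F̂₁, 0, Ĝ₁, F̂₂), (0, −F̂₁, 0, −Ĝ₁, 0, Ĝ₂), all evaluated at z. Then for every z ∈ Ω_I the 4×12 block matrix (A(z), −B(z)) has rank 4. -/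

import Mathlib

noncomputable section

/-- The 2-sphere of quaternionic imaginary units. -/
def QSphere : Set (Quaternion ℝ) := {q | q ^ 2 = -1}

/-- The complex plane `L_I = ℝ + ℝI` through an imaginary unit `I`. -/
def sliceL (I : Quaternion ℝ) : Set (Quaternion ℝ) :=
  {q | ∃ x y : ℝ, q = (x : Quaternion ℝ) + (y : Quaternion ℝ) * I}

/-- The planar parametrization of the restriction of `f` to the slice `L_I`. -/
def sliceMap (f : Quaternion ℝ → Quaternion ℝ) (I : Quaternion ℝ) : ℝ × ℝ → Quaternion ℝ :=
  fun p => f ((p.1 : Quaternion ℝ) + (p.2 : Quaternion ℝ) * I)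

/-- `f` is holomorphic (has continuous partial derivatives and satisfies
`(∂/∂x + I ∂/∂y) f = 0`) at the points of `U` lying in the slice `L_I`. -/
def HoloSlice (f : Quaternion ℝ → Quaternion ℝ) (I : Quaternion ℝ)
    (U : Set (Quaternion ℝ)) : Prop :=
  ∀ x y : ℝ, (x : Quaternion ℝ) + (y : Quaternion ℝ) * I ∈ U →
    ContDiffAt ℝ 1 (sliceMap f I) (x, y) ∧
    fderiv ℝ (sliceMap f I) (x, y) (1, 0) + I * fderiv ℝ (sliceMap f I) (x, y) (0, 1) = 0

/-- `f` is slice regular on `Ω`. -/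
def SliceRegularOn (f : Quaternion ℝ → Quaternion ℝ) (Ω : Set (Quaternion ℝ)) : Prop :=
  ∀ I ∈ QSphere, HoloSlice f I Ω

/-- `Ω` is a symmetric slice domain. -/
def IsSymmSliceDomain (Ω : Set (Quaternion ℝ)) : Prop :=
  IsOpen Ω ∧ IsConnected Ω ∧ (∃ x : ℝ, (x : Quaternion ℝ) ∈ Ω) ∧
  (∀ I ∈ QSphere, IsConnected (Ω ∩ sliceL I)) ∧
  (∀ x y : ℝ, ∀ I ∈ QSphere, (x : Quaternion ℝ) + (y : Quaternion ℝ) * I ∈ Ω →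
    ∀ J ∈ QSphere, (x : Quaternion ℝ) + (y : Quaternion ℝ) * J ∈ Ω)


/-- The identification of `ℂ` with the slice `L_I = ℝ + ℝI`: `x + yi ↦ x + yI`. -/
def toSlice (I : Quaternion ℝ) (w : ℂ) : Quaternion ℝ :=
  (w.re : Quaternion ℝ) + (w.im : Quaternion ℝ) * I

/-- The hat operation `Ĥ(z) = conj (H (z̄))`. -/
def hatC (H : ℂ → ℂ) (w : ℂ) : ℂ := starRingEnd ℂ (H (starRingEnd ℂ w))

/-- The `4 × 12` block matrix `(A, −B)` built from the splitting data `F₁, G₁, F₂, G₂`,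
where the columns of `A` are the standard generators of the syzygies of
`(F₁, G₁, F₂, G₂)` and `B` is the companion matrix of hatted functions. -/
def syzygyBlockMatrix (F₁ G₁ F₂ G₂ : ℂ → ℂ) (w : ℂ) : Matrix (Fin 4) (Fin 12) ℂ :=
  Matrix.of
    ![![G₁ w, F₂ w, G₂ w, 0, 0, 0,
        -(hatC F₁ w), 0, 0, hatC F₂ w, hatC G₂ w, 0],
      ![-(F₁ w), 0, 0, F₂ w, G₂ w, 0,
        -(hatC G₁ w), -(hatC F₂ w), -(hatC G₂ w), 0, 0, 0],
      ![0, -(F₁ w), 0, -(G₁ w), 0, G₂ w,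
        0, 0, -(hatC F₁ w), 0, -(hatC G₁ w), -(hatC F₂ w)],
      ![0, 0, -(F₁ w), 0, -(G₁ w), -(F₂ w),
        0, hatC F₁ w, 0, hatC G₁ w, 0, -(hatC G₂ w)]]

lemma re_eq_zero_of_mem_QSphere {K : Quaternion ℝ} (hK : K ∈ QSphere) : K.re = 0 := by
  have h : K * K = -1 := by rw [← sq]; exact hK
  have h0 := congrArg (fun q : Quaternion ℝ => q.re) h
  have h1 := congrArg (fun q : Quaternion ℝ => q.imI) h
  have h2 := congrArg (fun q : Quaternion ℝ => q.imJ) h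
  have h3 := congrArg (fun q : Quaternion ℝ => q.imK) h
  simp only [Quaternion.re_mul, Quaternion.imI_mul, Quaternion.imJ_mul, Quaternion.imK_mul,
    Quaternion.re_neg, Quaternion.imI_neg, Quaternion.imJ_neg, Quaternion.imK_neg,
    Quaternion.re_one, Quaternion.imI_one, Quaternion.imJ_one, Quaternion.imK_one] at h0 h1 h2 h3
  by_contra hne
  have e1 : K.imI = 0 := by
    apply (mul_eq_zero.mp (show K.re * K.imI = 0 by linarith)).resolve_left hne
  have e2 : K.imJ = 0 := by
    apply (mul_eq_zero.mp (show K.re * K.imJ = 0 by linarith)).resolve_left hne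
  have e3 : K.imK = 0 := by
    apply (mul_eq_zero.mp (show K.re * K.imK = 0 by linarith)).resolve_left hne
  rw [e1, e2, e3] at h0
  nlinarith [sq_nonneg K.re]

lemma mul_self_of_mem_QSphere {K : Quaternion ℝ} (hK : K ∈ QSphere) : K * K = -1 := by
  rw [← sq]; exact hK

lemma toSlice_eq_smul (I : Quaternion ℝ) (w : ℂ) :
    toSlice I w = w.re • (1 : Quaternion ℝ) + w.im • I := by
  rw [toSlice, Quaternion.coe_mul_eq_smul, ← Quaternion.coe_mul_eq_smul w.re 1, mul_one]

lemma toSlice_mul {I : Quaternion ℝ} (hI : I ∈ QSphere) (u v : ℂ) :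
    toSlice I (u * v) = toSlice I u * toSlice I v := by
  simp only [toSlice_eq_smul, Complex.mul_re, Complex.mul_im, mul_add, add_mul, smul_mul_assoc,
    mul_smul_comm, one_mul, mul_one, mul_self_of_mem_QSphere hI]
  module

lemma toSlice_neg (I : Quaternion ℝ) (u : ℂ) : toSlice I (-u) = -toSlice I u := by
  simp only [toSlice_eq_smul, Complex.neg_re, Complex.neg_im]
  module

/-- An imaginary unit orthogonal to `I` intertwines the conjugation of the slice `L_I`. -/
lemma mul_toSlice {I J : Quaternion ℝ} (hIJ : I * J = -(J * I)) (u : ℂ) :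
    J * toSlice I u = toSlice I (starRingEnd ℂ u) * J := by
  simp only [toSlice_eq_smul, Complex.conj_re, Complex.conj_im, mul_add, add_mul, smul_mul_assoc,
    mul_smul_comm, one_mul, mul_one, hIJ]
  module

lemma continuous_toSlice (I : Quaternion ℝ) : Continuous (toSlice I) := by
  simp only [funext (toSlice_eq_smul I)]
  fun_prop

lemma IsSymmSliceDomain.toSlice_conj_mem {Ω : Set (Quaternion ℝ)} (hΩ : IsSymmSliceDomain Ω)
    {I : Quaternion ℝ} (hI : I ∈ QSphere) {w : ℂ} (hw : toSlice I w ∈ Ω) :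
    toSlice I (starRingEnd ℂ w) ∈ Ω := by
  have hneg : -I ∈ QSphere := by
    change (-I) ^ 2 = -1
    rw [neg_sq]
    exact hI
  simpa [toSlice] using hΩ.2.2.2.2 w.re w.im I hI hw (-I) hneg

/-- The slice of a symmetric slice domain, seen in `ℂ`, is connected. -/
lemma isPreconnected_toSlice_preimage {Ω : Set (Quaternion ℝ)} (hΩ : IsSymmSliceDomain Ω)
    {K : Quaternion ℝ} (hK : K ∈ QSphere) : IsPreconnected (toSlice K ⁻¹' Ω) := by
  let r : Quaternion ℝ → ℂ := fun q => (q.re : ℂ) - ((q * K).re : ℂ) * Complex.I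
  have hr : Continuous r := by
    have h1 : Continuous fun q : Quaternion ℝ => (q * K).re :=
      Quaternion.continuous_re.comp (continuous_id.mul continuous_const)
    have h2 := Quaternion.continuous_re
    exact (Complex.continuous_ofReal.comp h2).sub
      ((Complex.continuous_ofReal.comp h1).mul continuous_const)
  have hleft : ∀ w, r (toSlice K w) = w := by
    intro w
    have h0 := re_eq_zero_of_mem_QSphere hK
    have hmul : toSlice K w * K = w.re • K - w.im • (1 : Quaternion ℝ) := by
      rw [toSlice_eq_smul, add_mul, smul_mul_assoc, smul_mul_assoc, one_mul,
        mul_self_of_mem_QSphere hK, smul_neg, sub_eq_add_neg]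
    have hre : (toSlice K w).re = w.re := by simp [toSlice_eq_smul, h0, Quaternion.re_one]
    have him : (toSlice K w * K).re = -w.im := by simp [hmul, h0, Quaternion.re_one]
    apply Complex.ext <;> simp only [r, hre, him] <;> simp
  have himage : toSlice K ⁻¹' Ω = r '' (Ω ∩ sliceL K) := by
    ext w
    constructor
    · intro hw
      exact ⟨toSlice K w, ⟨hw, w.re, w.im, rfl⟩, hleft w⟩
    · rintro ⟨q, ⟨hq, x, y, rfl⟩, rfl⟩
      have h : r ((x : Quaternion ℝ) + (y : Quaternion ℝ) * K) = ⟨x, y⟩ := hleft ⟨x, y⟩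
      rw [Set.mem_preimage, h]
      exact hq
  rw [himage]
  exact (hΩ.2.2.2.1 K hK).isPreconnected.image r hr.continuousOn

/-- The `ℝ`-linear functional `q ↦ Re (q c) - i Re (K q c)`, which intertwines left
multiplication by `K` with multiplication by `i`. -/
def sliceFunctional (K c : Quaternion ℝ) : Quaternion ℝ →L[ℝ] ℂ :=
  LinearMap.toContinuousLinearMap
    { toFun := fun q => ((q * c).re : ℂ) - ((K * q * c).re : ℂ) * Complex.I
      map_add' := fun p q => by
        simp only [add_mul, mul_add, Quaternion.re_add, Complex.ofReal_add]
        ring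
      map_smul' := fun t q => by
        simp only [smul_mul_assoc, mul_smul_comm, Quaternion.re_smul, smul_eq_mul,
          Complex.ofReal_mul, RingHom.id_apply, Complex.real_smul]
        ring }

lemma sliceFunctional_apply (K c q : Quaternion ℝ) :
    sliceFunctional K c q = ((q * c).re : ℂ) - ((K * q * c).re : ℂ) * Complex.I := rfl

lemma sliceFunctional_mul_left {K : Quaternion ℝ} (hK : K ∈ QSphere) (c q : Quaternion ℝ) :
    sliceFunctional K c (K * q) = Complex.I * sliceFunctional K c q := by
  have h : K * (K * q) = -q := by rw [← mul_assoc, mul_self_of_mem_QSphere hK, neg_one_mul]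
  rw [sliceFunctional_apply, sliceFunctional_apply, h, neg_mul, Quaternion.re_neg,
    Complex.ofReal_neg]
  linear_combination ((K * q * c).re : ℂ) * Complex.I_mul_I

lemma eq_zero_of_sliceFunctional {K q : Quaternion ℝ} (h : ∀ c, sliceFunctional K c q = 0) :
    q = 0 := by
  have h1 := congrArg Complex.re (h (star q))
  rw [sliceFunctional_apply, Quaternion.self_mul_star] at h1
  simpa using h1

/-- Identity principle for quaternion-valued functions on a planar domain which satisfy the
Cauchy–Riemann equation with respect to the imaginary unit `K`. -/
lemma eqOn_zero_of_cauchyRiemann {K : Quaternion ℝ} (hK : K ∈ QSphere) {U : Set ℂ}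
    (hU : IsOpen U) (hUc : IsPreconnected U) {h : ℂ → Quaternion ℝ}
    (hd : ∀ w ∈ U, ∃ L : ℂ →L[ℝ] Quaternion ℝ, HasFDerivAt h L w ∧ L 1 + K * L Complex.I = 0)
    (hreal : ∀ x : ℝ, (x : ℂ) ∈ U → h x = 0) {x₀ : ℝ} (hx₀ : (x₀ : ℂ) ∈ U) :
    ∀ w ∈ U, h w = 0 := by
  intro w hw
  refine eq_zero_of_sliceFunctional (K := K) fun c => ?_
  have hdiff : DifferentiableOn ℂ (fun u => sliceFunctional K c (h u)) U := by
    intro u hu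
    obtain ⟨L, hL, hCR⟩ := hd u hu
    have hcomp : HasFDerivAt (fun u => sliceFunctional K c (h u)) ((sliceFunctional K c).comp L) u :=
      (sliceFunctional K c).hasFDerivAt.comp u hL
    refine (differentiableAt_complex_iff_differentiableAt_real.2
      ⟨hcomp.differentiableAt, ?_⟩).differentiableWithinAt
    rw [hcomp.fderiv, ContinuousLinearMap.comp_apply, ContinuousLinearMap.comp_apply,
      eq_neg_of_add_eq_zero_left hCR, map_neg, sliceFunctional_mul_left hK, smul_eq_mul]
    linear_combination (sliceFunctional K c (L Complex.I)) * (Complex.I_mul_I)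
  refine (hdiff.analyticOnNhd hU).eqOn_zero_of_preconnected_of_frequently_eq_zero hUc hx₀ ?_ hw
  have htend : Filter.Tendsto (fun x : ℝ => (x : ℂ)) (nhdsWithin x₀ {x₀}ᶜ)
      (nhdsWithin (x₀ : ℂ) {(x₀ : ℂ)}ᶜ) := by
    refine tendsto_nhdsWithin_of_tendsto_nhds_of_eventually_within _
      ((Complex.continuous_ofReal.tendsto x₀).mono_left nhdsWithin_le_nhds) ?_
    filter_upwards [self_mem_nhdsWithin] with x hx
    simpa using hx
  refine htend.frequently (Filter.Eventually.frequently ?_)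
  have hev : ∀ᶠ x : ℝ in nhds x₀, (x : ℂ) ∈ U :=
    (Complex.continuous_ofReal.tendsto x₀).eventually (hU.mem_nhds hx₀)
  filter_upwards [nhdsWithin_le_nhds hev] with x hx
  rw [hreal x hx, map_zero]

lemma HoloSlice.exists_hasFDerivAt {f : Quaternion ℝ → Quaternion ℝ} {I : Quaternion ℝ}
    {U : Set (Quaternion ℝ)} (hf : HoloSlice f I U) {w : ℂ} (hw : toSlice I w ∈ U) :
    ∃ L : ℂ →L[ℝ] Quaternion ℝ,
      HasFDerivAt (fun u => f (toSlice I u)) L w ∧ L 1 + I * L Complex.I = 0 := by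
  obtain ⟨hc, hCR⟩ := hf w.re w.im hw
  have hd : HasFDerivAt (sliceMap f I) (fderiv ℝ (sliceMap f I) (w.re, w.im))
      (Complex.equivRealProdCLM w) := (hc.differentiableAt (by norm_num)).hasFDerivAt
  refine ⟨_, hd.comp w Complex.equivRealProdCLM.hasFDerivAt, ?_⟩
  simpa using hCR

/-- The representation formula: the values of a slice regular function on a slice determine
its values on the whole symmetric slice domain. -/
lemma SliceRegularOn.two_mul_apply_toSlice {Ω : Set (Quaternion ℝ)} (hΩ : IsSymmSliceDomain Ω)
    {f : Quaternion ℝ → Quaternion ℝ} (hf : SliceRegularOn f Ω) {I K : Quaternion ℝ}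
    (hI : I ∈ QSphere) (hK : K ∈ QSphere) {w : ℂ} (hw : toSlice K w ∈ Ω) :
    2 * f (toSlice K w) = (1 - K * I) * f (toSlice I w) +
      (1 + K * I) * f (toSlice I (starRingEnd ℂ w)) := by
  have hII := mul_self_of_mem_QSphere hI
  have hKK := mul_self_of_mem_QSphere hK
  obtain ⟨x₀, hx₀⟩ := hΩ.2.2.1
  have hsymm := hΩ.2.2.2.2
  have hzero := eqOn_zero_of_cauchyRiemann hK (U := toSlice K ⁻¹' Ω)
    (h := fun u => 2 * f (toSlice K u) - ((1 - K * I) * f (toSlice I u) +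
      (1 + K * I) * f (toSlice I (starRingEnd ℂ u))))
    (hΩ.1.preimage (continuous_toSlice K)) (isPreconnected_toSlice_preimage hΩ hK)
    (x₀ := x₀) ?_ ?_ ?_ w hw
  · exact sub_eq_zero.mp hzero
  · intro u hu
    have hu' : toSlice I u ∈ Ω := hsymm u.re u.im K hK hu I hI
    have hu'' : toSlice I (starRingEnd ℂ u) ∈ Ω := hΩ.toSlice_conj_mem hI hu'
    obtain ⟨L, hL, hLCR⟩ := (hf K hK).exists_hasFDerivAt hu
    obtain ⟨M, hM, hMCR⟩ := (hf I hI).exists_hasFDerivAt hu'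
    obtain ⟨N, hN, hNCR⟩ := (hf I hI).exists_hasFDerivAt hu''
    have hN' : HasFDerivAt (fun u => f (toSlice I (starRingEnd ℂ u)))
        (N.comp (Complex.conjCLE : ℂ →L[ℝ] ℂ)) u := by
      have hc : HasFDerivAt (fun u : ℂ => starRingEnd ℂ u) (Complex.conjCLE : ℂ →L[ℝ] ℂ) u :=
        Complex.conjCLE.hasFDerivAt
      exact HasFDerivAt.comp u hN hc
    refine ⟨_, (hL.const_mul 2).sub ((hM.const_mul (1 - K * I)).add
      (hN'.const_mul (1 + K * I))), ?_⟩
    simp only [sub_apply, add_apply,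
      smul_apply, ContinuousLinearMap.comp_apply, smul_eq_mul,
      ContinuousLinearEquiv.coe_coe, Complex.conjCLE_apply, map_one, Complex.conj_I, map_neg]
    rw [eq_neg_of_add_eq_zero_left hLCR, eq_neg_of_add_eq_zero_left hMCR,
      eq_neg_of_add_eq_zero_left hNCR]
    have hKK' : ∀ q, K * (K * q) = -q := fun q => by rw [← mul_assoc, hKK, neg_one_mul]
    have hII' : ∀ q, I * (I * q) = -q := fun q => by rw [← mul_assoc, hII, neg_one_mul]
    simp only [mul_sub, mul_add, sub_mul, add_mul, mul_neg, one_mul, mul_assoc, hKK', hII',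
      two_mul]
    abel
  · intro x _
    have h : ∀ L, toSlice L (x : ℂ) = x := fun L => by simp [toSlice]
    simp only [Complex.conj_ofReal, h]
    noncomm_ring
  · simpa [toSlice] using hx₀

/-- All slice regular functions `f` with `f w = μ J f w̄` share a zero on the sphere
through `w`. -/
lemma exists_forall_apply_eq_zero {Ω : Set (Quaternion ℝ)} (hΩ : IsSymmSliceDomain Ω)
    {I J : Quaternion ℝ} (hI : I ∈ QSphere) (hJ : J ∈ QSphere) (hIJ : I * J = -(J * I))
    {w : ℂ} (hw : toSlice I w ∈ Ω) (μ : ℂ) :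
    ∃ q ∈ Ω, ∀ f, SliceRegularOn f Ω →
      f (toSlice I w) = toSlice I μ * J * f (toSlice I (starRingEnd ℂ w)) → f q = 0 := by
  have hII := mul_self_of_mem_QSphere hI
  have hJJ := mul_self_of_mem_QSphere hJ
  set a := toSlice I μ * J with ha
  set r : ℝ := Complex.normSq μ with hr
  have hr0 : (1 + r) ≠ 0 := by
    have := Complex.normSq_nonneg μ
    positivity
  have haa : a * a = -(r • (1 : Quaternion ℝ)) := by
    have : a * a = toSlice I (μ * starRingEnd ℂ μ) * (J * J) := by
      rw [toSlice_mul hI, ha, mul_assoc, ← mul_assoc J, mul_toSlice hIJ]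
      noncomm_ring
    rw [this, hJJ, Complex.mul_conj, toSlice_eq_smul]
    simp [hr]
  have hcomm : I * toSlice I μ = toSlice I μ * I := by
    simp only [toSlice_eq_smul, mul_add, add_mul, smul_mul_assoc, mul_smul_comm, one_mul, mul_one]
  have haI : I * a = -(a * I) := by
    rw [ha, ← mul_assoc, hcomm, mul_assoc, hIJ, mul_neg, mul_assoc]
  have haI' : ∀ q, I * (a * q) = -(a * (I * q)) := fun q => by
    rw [← mul_assoc, haI, neg_mul, mul_assoc]
  set K : Quaternion ℝ := (1 + r)⁻¹ • ((1 - r) • I + (2 : ℝ) • (a * I)) with hKdef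
  have hKI : K * I = (1 + r)⁻¹ • ((r - 1) • (1 : Quaternion ℝ) - (2 : ℝ) • a) := by
    rw [hKdef]
    simp only [add_mul, smul_mul_assoc, mul_assoc, hII]
    simp only [mul_neg, mul_one]
    module
  have hK : K ∈ QSphere := by
    change K ^ 2 = -1
    have : ((1 - r) • I + (2 : ℝ) • (a * I)) * ((1 - r) • I + (2 : ℝ) • (a * I)) =
        -((1 + r) ^ 2 • (1 : Quaternion ℝ)) := by
      simp only [add_mul, mul_add, smul_mul_assoc, mul_smul_comm, mul_assoc, hII, haI', haa,
        mul_neg, mul_one, smul_neg]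
      module
    rw [sq, hKdef, smul_mul_smul_comm, this, smul_neg, smul_smul]
    have : (1 + r)⁻¹ * (1 + r)⁻¹ * (1 + r) ^ 2 = 1 := by field_simp
    rw [this, one_smul]
  have hwK : toSlice K w ∈ Ω := hΩ.2.2.2.2 w.re w.im I hI hw K hK
  refine ⟨toSlice K w, hwK, fun f hf hfa => ?_⟩
  have h := hf.two_mul_apply_toSlice hΩ hI hK hwK
  have hcoef : (1 - K * I) * a + (1 + K * I) = 0 := by
    have h1 : (1 : Quaternion ℝ) = (1 + r)⁻¹ • ((1 + r) • (1 : Quaternion ℝ)) := by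
      rw [smul_smul, inv_mul_cancel₀ hr0, one_smul]
    have e1 : 1 - K * I = (1 + r)⁻¹ • ((2 : ℝ) • (1 : Quaternion ℝ) + (2 : ℝ) • a) := by
      rw [hKI]; nth_rewrite 1 [h1]; module
    have e2 : 1 + K * I = (1 + r)⁻¹ • ((2 * r) • (1 : Quaternion ℝ) - (2 : ℝ) • a) := by
      rw [hKI]; nth_rewrite 1 [h1]; module
    rw [e1, e2]
    simp only [add_mul, smul_mul_assoc, one_mul, haa]
    module
  rw [hfa, ← mul_assoc, ← add_mul, hcoef, zero_mul] at h
  rw [two_mul, ← two_smul ℝ] at h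
  exact (smul_eq_zero.mp h).resolve_left two_ne_zero

lemma exists_eq_smul_of_mul_eq_mul {ι k : Type*} [Field k] {p v : ι → k} (hp : p ≠ 0)
    (h : ∀ i j, v i * p j = v j * p i) : ∃ s : k, v = s • p := by
  obtain ⟨j, hj⟩ := Function.ne_iff.mp hp
  refine ⟨v j / p j, funext fun i => ?_⟩
  simp only [Pi.zero_apply] at hj
  rw [Pi.smul_apply, smul_eq_mul, div_mul_eq_mul_div, ← h i j, mul_div_cancel_right₀ _ hj]

/-- Left multiplication by `μ J` relates the values at `w` and `w̄` of a splitting `F + G J`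
for which `(F, G)` is `μ` times `(-Ĝ, F̂)` at `w`. -/
lemma apply_toSlice_eq_of_splitting {I J : Quaternion ℝ} (hI : I ∈ QSphere) (hJ : J ∈ QSphere)
    (hIJ : I * J = -(J * I)) {μ : ℂ} {F G : ℂ → ℂ} {w : ℂ}
    (hF : F w = -(μ * hatC G w)) (hG : G w = μ * hatC F w) :
    toSlice I (F w) + toSlice I (G w) * J = toSlice I μ * J *
      (toSlice I (F (starRingEnd ℂ w)) + toSlice I (G (starRingEnd ℂ w)) * J) := by
  rw [hF, hG, hatC, hatC, toSlice_neg, toSlice_mul hI, toSlice_mul hI, mul_add, mul_assoc _ J,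
    mul_assoc _ J, ← mul_assoc J _ J, mul_toSlice hIJ, mul_toSlice hIJ, mul_assoc _ J J,
    mul_self_of_mem_QSphere hJ]
  noncomm_ring

/-- A row vector killed by the block `A` is proportional to `(F₁, G₁, F₂, G₂)`. -/
lemma mul_eq_mul_of_syzygy_columns {F₁ G₁ F₂ G₂ : ℂ → ℂ} {w : ℂ} {v : Fin 4 → ℂ}
    (hcol : ∀ j, ∑ i, v i * syzygyBlockMatrix F₁ G₁ F₂ G₂ w i j = 0) (i j : Fin 4) :
    v i * ![F₁ w, G₁ w, F₂ w, G₂ w] j =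
      v j * ![F₁ w, G₁ w, F₂ w, G₂ w] i := by
  have c0 := hcol 0
  have c1 := hcol 1
  have c2 := hcol 2
  have c3 := hcol 3
  have c4 := hcol 4
  have c5 := hcol 5
  simp [syzygyBlockMatrix, Fin.sum_univ_four] at c0 c1 c2 c3 c4 c5
  fin_cases i <;> fin_cases j <;> simp <;> first
    | linear_combination c0
    | linear_combination -c0
    | linear_combination c1
    | linear_combination -c1
    | linear_combination c2
    | linear_combination -c2
    | linear_combination c3
    | linear_combination -c3
    | linear_combination c4
    | linear_combination -c4
    | linear_combination c5
    | linear_combination -c5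

/-- A row vector killed by the block `-B` is proportional to `(-Ĝ₁, F̂₁, -Ĝ₂, F̂₂)`. -/
lemma mul_eq_mul_of_companion_columns {F₁ G₁ F₂ G₂ : ℂ → ℂ} {w : ℂ} {v : Fin 4 → ℂ}
    (hcol : ∀ j, ∑ i, v i * syzygyBlockMatrix F₁ G₁ F₂ G₂ w i j = 0) (i j : Fin 4) :
    v i * ![-(hatC G₁ w), hatC F₁ w, -(hatC G₂ w), hatC F₂ w] j =
      v j * ![-(hatC G₁ w), hatC F₁ w, -(hatC G₂ w), hatC F₂ w] i := by
  have c0 := hcol 6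
  have c1 := hcol 7
  have c2 := hcol 8
  have c3 := hcol 9
  have c4 := hcol 10
  have c5 := hcol 11
  simp [syzygyBlockMatrix, Fin.sum_univ_four] at c0 c1 c2 c3 c4 c5
  fin_cases i <;> fin_cases j <;> simp <;> first
    | linear_combination c0
    | linear_combination -c0
    | linear_combination c1
    | linear_combination -c1
    | linear_combination c2
    | linear_combination -c2
    | linear_combination c3
    | linear_combination -c3
    | linear_combination c4
    | linear_combination -c4
    | linear_combination c5
    | linear_combination -c5

lemma rank_eq_card_of_left_kernel_eq_zero {m n k : Type*} [Fintype m] [Fintype n] [Field k]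
    (M : Matrix m n k) (h : ∀ v : m → k, (∀ j, ∑ i, v i * M i j = 0) → v = 0) :
    M.rank = Fintype.card m := by
  have hli : LinearIndependent k M.row := by
    refine Fintype.linearIndependent_iff.mpr fun v hv i => congrFun (h v fun j => ?_) i
    have hj := congrFun hv j
    rwa [Finset.sum_apply] at hj
  exact hli.rank_matrix

/-- If `f₁, f₂` are slice regular on a symmetric slice domain `Ω` with no common zeros
and `f_ℓ = F_ℓ + G_ℓ J` is a splitting on `Ω_I` (identified with a subset of `ℂ` via
`toSlice I`), then the `4 × 12` matrix `(A, −B)` has rank `4` at every point of `Ω_I`. -/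
theorem syzygy_block_matrix_has_full_rank
    (Ω : Set (Quaternion ℝ)) (hΩ : IsSymmSliceDomain Ω)
    (f₁ f₂ : Quaternion ℝ → Quaternion ℝ)
    (hreg₁ : SliceRegularOn f₁ Ω) (hreg₂ : SliceRegularOn f₂ Ω)
    (hnz : ∀ q ∈ Ω, f₁ q ≠ 0 ∨ f₂ q ≠ 0)
    (I J : Quaternion ℝ) (hI : I ∈ QSphere) (hJ : J ∈ QSphere)
    (hIJ : I * J = -(J * I))
    (F₁ G₁ F₂ G₂ : ℂ → ℂ)
    (hF₁ : DifferentiableOn ℂ F₁ {w : ℂ | toSlice I w ∈ Ω})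
    (hG₁ : DifferentiableOn ℂ G₁ {w : ℂ | toSlice I w ∈ Ω})
    (hF₂ : DifferentiableOn ℂ F₂ {w : ℂ | toSlice I w ∈ Ω})
    (hG₂ : DifferentiableOn ℂ G₂ {w : ℂ | toSlice I w ∈ Ω})
    (hsplit₁ : ∀ w : ℂ, toSlice I w ∈ Ω →
      f₁ (toSlice I w) = toSlice I (F₁ w) + toSlice I (G₁ w) * J)
    (hsplit₂ : ∀ w : ℂ, toSlice I w ∈ Ω →
      f₂ (toSlice I w) = toSlice I (F₂ w) + toSlice I (G₂ w) * J) :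
    ∀ w : ℂ, toSlice I w ∈ Ω → (syzygyBlockMatrix F₁ G₁ F₂ G₂ w).rank = 4 := by
  intro w hw
  have hw' : toSlice I (starRingEnd ℂ w) ∈ Ω := hΩ.toSlice_conj_mem hI hw
  have hsplit_ne : ∀ u, toSlice I u ∈ Ω → ¬ (F₁ u = 0 ∧ G₁ u = 0 ∧ F₂ u = 0 ∧ G₂ u = 0) := by
    rintro u hu ⟨h1, h2, h3, h4⟩
    have e1 := hsplit₁ u hu
    have e2 := hsplit₂ u hu
    rw [h1, h2] at e1
    rw [h3, h4] at e2
    have h0 : toSlice I 0 = 0 := by simp [toSlice]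
    rw [h0, zero_mul, add_zero] at e1 e2
    exact (hnz _ hu).elim (fun h => h e1) (fun h => h e2)
  have hp : ![F₁ w, G₁ w, F₂ w, G₂ w] ≠ 0 := fun h => hsplit_ne w hw
    ⟨congrFun h 0, congrFun h 1, congrFun h 2, congrFun h 3⟩
  have hq : ![-(hatC G₁ w), hatC F₁ w, -(hatC G₂ w), hatC F₂ w] ≠ 0 := fun h => by
    have h0 := congrFun h 0
    have h1 := congrFun h 1
    have h2 := congrFun h 2
    have h3 := congrFun h 3
    simp [hatC] at h0 h1 h2 h3
    exact hsplit_ne _ hw' ⟨h1, h0, h3, h2⟩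
  refine (rank_eq_card_of_left_kernel_eq_zero _ fun v hcol => ?_).trans (Fintype.card_fin 4)
  obtain ⟨s, hs⟩ := exists_eq_smul_of_mul_eq_mul (v := v) hp
    (mul_eq_mul_of_syzygy_columns hcol)
  obtain ⟨t, ht⟩ := exists_eq_smul_of_mul_eq_mul (v := v) hq
    (mul_eq_mul_of_companion_columns hcol)
  by_cases hs0 : s = 0
  · rw [hs, hs0, zero_smul]
  exfalso
  have hst : ∀ i, s * ![F₁ w, G₁ w, F₂ w, G₂ w] i =
      t * ![-(hatC G₁ w), hatC F₁ w, -(hatC G₂ w), hatC F₂ w] i := fun i =>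
    congrFun (hs.symm.trans ht) i
  have e0 := hst 0
  have e1 := hst 1
  have e2 := hst 2
  have e3 := hst 3
  simp at e0 e1 e2 e3
  obtain ⟨q, hqΩ, hzero⟩ := exists_forall_apply_eq_zero hΩ hI hJ hIJ hw (t / s)
  have z1 : f₁ q = 0 := hzero f₁ hreg₁ (by
    rw [hsplit₁ w hw, hsplit₁ _ hw']
    exact apply_toSlice_eq_of_splitting hI hJ hIJ (by field_simp; linear_combination e0)
      (by field_simp; linear_combination e1))
  have z2 : f₂ q = 0 := hzero f₂ hreg₂ (by
    rw [hsplit₂ w hw, hsplit₂ _ hw']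
    exact apply_toSlice_eq_of_splitting hI hJ hIJ (by field_simp; linear_combination e2)
      (by field_simp; linear_combination e3))
  exact (hnz q hqΩ).elim (fun h => h z1) (fun h => h z2)
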